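/- Let (V,q) be a quadratic space over ℚ₂ of dimension d ≥ 3, let L be an odd unimodular lattice in (V,q), and let Λ = {x ∈ L : q(x) ∈ 2ℤ₂}. If (V,q) does not contain any even unimodular lattice, then Λ is a maximal lattice in (V, ½q): ½q takes values in ℤ₂ on Λ and on no lattice strictly containing Λ. -/

import Mathlib

/-- The symmetric bilinear form `B_q(x,y) = (q(x+y) - q(x) - q(y))/2` associated to a
quadratic form `q` on a `ℚ₂`-vector space `V`. -/
noncomputable def Bq {V : Type*} [AddCommGroup V] [Module ℚ_[2] V]
    (q : QuadraticForm ℚ_[2] V) (x y : V) : ℚ_[2] :=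
  (q (x + y) - q x - q y) / 2

/-- An element `c : ℚ₂` lies in `ℤ₂ ⊆ ℚ₂` iff its 2-adic norm is at most 1. -/
def IsIntegral2 (c : ℚ_[2]) : Prop := ‖c‖ ≤ 1

/-- A lattice in a `ℚ₂`-vector space `V`: a finitely generated `ℤ₂`-submodule
that spans `V` over `ℚ₂`. -/
def IsLattice {V : Type*} [AddCommGroup V] [Module ℚ_[2] V] [Module ℤ_[2] V]
    [IsScalarTower ℤ_[2] ℚ_[2] V] (L : Submodule ℤ_[2] V) : Prop :=
  L.FG ∧ Submodule.span ℚ_[2] (L : Set V) = ⊤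

/-- `x` lies in the dual lattice `L* = {x ∈ V : B_q(x, L) ⊆ ℤ₂}` of `L`. -/
def InDual {V : Type*} [AddCommGroup V] [Module ℚ_[2] V] [Module ℤ_[2] V]
    [IsScalarTower ℤ_[2] ℚ_[2] V] (q : QuadraticForm ℚ_[2] V) (L : Submodule ℤ_[2] V)
    (x : V) : Prop :=
  ∀ y ∈ L, IsIntegral2 (Bq q x y)

/-- `L` is unimodular: the dual lattice `L*` equals `L`. -/
def IsUnimodular {V : Type*} [AddCommGroup V] [Module ℚ_[2] V] [Module ℤ_[2] V]
    [IsScalarTower ℤ_[2] ℚ_[2] V] (q : QuadraticForm ℚ_[2] V) (L : Submodule ℤ_[2] V) : Prop :=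
  ∀ x : V, InDual q L x ↔ x ∈ L

/-- A lattice `L` is even when `q(L) ⊆ 2ℤ₂`; a unimodular lattice is odd when it is not even. -/
def IsEvenLat {V : Type*} [AddCommGroup V] [Module ℚ_[2] V] [Module ℤ_[2] V]
    [IsScalarTower ℤ_[2] ℚ_[2] V] (q : QuadraticForm ℚ_[2] V) (L : Submodule ℤ_[2] V) : Prop :=
  ∀ x ∈ L, IsIntegral2 (q x / 2)

/-- `L` is a maximal lattice for the form `q'` on `V`: `q'` takes values in `ℤ₂` on `L`
and on no lattice strictly containing `L`. -/
def IsMaximalLat {V : Type*} [AddCommGroup V] [Module ℚ_[2] V] [Module ℤ_[2] V]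
    [IsScalarTower ℤ_[2] ℚ_[2] V] (q' : V → ℚ_[2]) (L : Submodule ℤ_[2] V) : Prop :=
  (∀ x ∈ L, IsIntegral2 (q' x)) ∧
    ∀ M : Submodule ℤ_[2] V, IsLattice M → L < M → ¬ (∀ x ∈ M, IsIntegral2 (q' x))

theorem IsIntegral2.add {a b : ℚ_[2]} (ha : IsIntegral2 a) (hb : IsIntegral2 b) :
    IsIntegral2 (a + b) :=
  (Padic.nonarchimedean a b).trans (max_le ha hb)

theorem IsIntegral2.neg {a : ℚ_[2]} (ha : IsIntegral2 a) : IsIntegral2 (-a) := by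
  simpa [IsIntegral2] using ha

theorem IsIntegral2.sub {a b : ℚ_[2]} (ha : IsIntegral2 a) (hb : IsIntegral2 b) :
    IsIntegral2 (a - b) := by
  simpa only [sub_eq_add_neg] using ha.add hb.neg

theorem IsIntegral2.mul {a b : ℚ_[2]} (ha : IsIntegral2 a) (hb : IsIntegral2 b) :
    IsIntegral2 (a * b) := by
  unfold IsIntegral2 at *
  rw [norm_mul]
  exact mul_le_one₀ ha (norm_nonneg _) hb

theorem isIntegral2_two : IsIntegral2 2 := by
  unfold IsIntegral2
  exact_mod_cast Padic.norm_int_le_one (p := 2) 2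

theorem exists_isIntegral2_half_or_half_sub_one {u : ℚ_[2]} (hu : IsIntegral2 u) :
    IsIntegral2 (u / 2) ∨ IsIntegral2 ((u - 1) / 2) := by
  obtain ⟨n, hn, hmem⟩ := PadicInt.exists_mem_range (p := 2) ⟨u, hu⟩
  rw [PadicInt.maximalIdeal_eq_span_p, Ideal.mem_span_singleton] at hmem
  obtain ⟨c, hc⟩ := hmem
  have hc' : u - n = 2 * c := congrArg ((↑) : ℤ_[2] → ℚ_[2]) hc
  have key : (u - n) / 2 = c := by rw [hc']; ring
  have hint : IsIntegral2 ((u - n) / 2) := key ▸ c.2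
  interval_cases n
  · left; simpa using hint
  · right; simpa using hint

/-- The nonzero class of `½ℤ₂ / ℤ₂` is unique. -/
theorem isIntegral2_sub_of_not_isIntegral2 {a b : ℚ_[2]} (ha2 : IsIntegral2 (2 * a))
    (hb2 : IsIntegral2 (2 * b)) (ha : ¬ IsIntegral2 a) (hb : ¬ IsIntegral2 b) :
    IsIntegral2 (a - b) := by
  have half : ∀ {c : ℚ_[2]}, IsIntegral2 (2 * c) → ¬ IsIntegral2 c →
      IsIntegral2 ((2 * c - 1) / 2) := fun {c} h2 h =>
    (exists_isIntegral2_half_or_half_sub_one h2).resolve_left fun h' =>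
      h (by simpa using h')
  have h := (half ha2 ha).sub (half hb2 hb)
  ring_nf at h ⊢
  exact h

section Bq

variable {V : Type*} [AddCommGroup V] [Module ℚ_[2] V] (q : QuadraticForm ℚ_[2] V)

theorem Bq_eq_polar (x y : V) : Bq q x y = QuadraticMap.polar q x y / 2 := rfl

theorem Bq_comm (x y : V) : Bq q x y = Bq q y x := by
  rw [Bq_eq_polar, Bq_eq_polar, QuadraticMap.polar_comm]

theorem Bq_sub_left (x y z : V) : Bq q (x - y) z = Bq q x z - Bq q y z := by
  simp only [Bq_eq_polar, QuadraticMap.polar_sub_left]; ring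

theorem Bq_sub_right (x y z : V) : Bq q x (y - z) = Bq q x y - Bq q x z := by
  simp only [Bq_eq_polar, QuadraticMap.polar_sub_right]; ring

theorem Bq_add_right (x y z : V) : Bq q x (y + z) = Bq q x y + Bq q x z := by
  simp only [Bq_eq_polar, QuadraticMap.polar_add_right]; ring

theorem Bq_two_smul_right (x y : V) : Bq q x ((2 : ℚ_[2]) • y) = 2 * Bq q x y := by
  simp only [Bq_eq_polar, QuadraticMap.polar_smul_right, smul_eq_mul]; ring

theorem Bq_self (x : V) : Bq q x x = q x := by
  simp only [Bq_eq_polar, QuadraticMap.polar_self]; ring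

theorem map_sub_eq_Bq (x y : V) : q (x - y) = q x + q y - 2 * Bq q x y := by
  have h := Bq_sub_left q x y (x - y)
  rw [Bq_self, Bq_sub_right, Bq_sub_right, Bq_self, Bq_self, Bq_comm q y x] at h
  rw [h]; ring

end Bq

/-- Let `L` be an odd unimodular lattice in `(V, q)` over `ℚ₂` (`dim V ≥ 3`) and
`Λ = {x ∈ L : q(x) ∈ 2ℤ₂}`. If `(V, q)` contains no even unimodular lattice, then `Λ` is a
maximal lattice in `(V, ½q)`. -/
theorem kernel_maximal_if_no_even_unimodular
    {V : Type*} [AddCommGroup V] [Module ℚ_[2] V] [Module ℤ_[2] V]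
    [IsScalarTower ℤ_[2] ℚ_[2] V] [FiniteDimensional ℚ_[2] V]
    (d : ℕ) (hd : 3 ≤ d) (hdim : Module.finrank ℚ_[2] V = d)
    (q : QuadraticForm ℚ_[2] V)
    (hnd : ∀ x : V, (∀ y : V, Bq q x y = 0) → x = 0)
    (L : Submodule ℤ_[2] V) (hL : IsLattice L)
    (hLuni : IsUnimodular q L) (hLodd : ¬ IsEvenLat q L)
    (Λ : Submodule ℤ_[2] V)
    (hΛ : (Λ : Set V) = {x : V | x ∈ L ∧ IsIntegral2 (q x / 2)})
    (hnoeven : ¬ ∃ L' : Submodule ℤ_[2] V, IsLattice L' ∧ IsUnimodular q L' ∧ IsEvenLat q L') :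
    IsLattice Λ ∧ IsMaximalLat (fun x : V => q x / 2) Λ := by
  have memΛ : ∀ x, x ∈ Λ ↔ x ∈ L ∧ IsIntegral2 (q x / 2) := fun x => Set.ext_iff.1 hΛ x
  have hΛL : Λ ≤ L := fun x hx => ((memΛ x).1 hx).1
  have hBL : ∀ x ∈ L, ∀ y ∈ L, IsIntegral2 (Bq q x y) := fun x hx => (hLuni x).2 hx
  have hqL : ∀ x ∈ L, IsIntegral2 (q x) := fun x hx => Bq_self q x ▸ hBL x hx x hx
  have two_mem : ∀ x ∈ L, (2 : ℚ_[2]) • x ∈ Λ := by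
    intro x hx
    refine (memΛ _).2 ⟨by simpa only [two_smul] using L.add_mem hx hx, ?_⟩
    have : q ((2 : ℚ_[2]) • x) / 2 = 2 * q x := by
      rw [QuadraticMap.map_smul, smul_eq_mul]; ring
    exact this ▸ isIntegral2_two.mul (hqL x hx)
  refine ⟨⟨?_, ?_⟩, fun x hx => ((memΛ x).1 hx).2, fun M hM hΛM hMint => ?_⟩
  · have := isNoetherian_of_fg_of_noetherian L hL.1
    exact (isNoetherian_submodule.1 this) Λ hΛL
  · rw [eq_top_iff, ← hL.2, Submodule.span_le]
    intro x hx
    have h := Submodule.smul_mem _ (2 : ℚ_[2])⁻¹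
      (Submodule.subset_span (R := ℚ_[2]) (s := (Λ : Set V)) (two_mem x hx))
    rwa [inv_smul_smul₀ two_ne_zero] at h
  · obtain ⟨hle, m, hmM, hmΛ⟩ := SetLike.lt_iff_le_and_exists.1 hΛM
    have hBM : ∀ x ∈ M, ∀ y ∈ M, IsIntegral2 (Bq q x y) := by
      intro x hx y hy
      have h := ((hMint _ (M.add_mem hx hy)).sub (hMint x hx)).sub (hMint y hy)
      have e : Bq q x y = q (x + y) / 2 - q x / 2 - q y / 2 := by unfold Bq; ring
      exact e ▸ h
    obtain ⟨e, heL, he⟩ : ∃ e ∈ L, ¬ IsIntegral2 (q e / 2) := by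
      simpa [IsEvenLat] using hLodd
    have coset : ∀ x ∈ L, x ∉ Λ → x - e ∈ Λ := by
      intro x hx hxΛ
      have hx2 : ¬ IsIntegral2 (q x / 2) := fun h => hxΛ ((memΛ x).2 ⟨hx, h⟩)
      refine (memΛ _).2 ⟨L.sub_mem hx heL, ?_⟩
      have h := (isIntegral2_sub_of_not_isIntegral2
        (by simpa [mul_div_cancel₀] using hqL x hx) (by simpa [mul_div_cancel₀] using hqL e heL)
        hx2 he).add ((hqL e heL).sub (hBL x hx e heL))
      have e' : q (x - e) / 2 = q x / 2 - q e / 2 + (q e - Bq q x e) := by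
        rw [map_sub_eq_Bq]; ring
      exact e' ▸ h
    have mem_L : ∀ x, InDual q Λ x → IsIntegral2 (Bq q x e) → x ∈ L := by
      intro x hx hxe
      refine (hLuni x).1 fun y hy => ?_
      by_cases hyΛ : y ∈ Λ
      · exact hx y hyΛ
      · have h := (hx _ (coset y hy hyΛ)).add hxe
        rwa [← Bq_add_right, sub_add_cancel] at h
    have dual_mono : ∀ x, InDual q M x → InDual q Λ x := fun x hx y hy => hx y (hle hy)
    have two_Bq : ∀ x, InDual q Λ x → IsIntegral2 (2 * Bq q x e) := fun x hx => by
      simpa only [Bq_two_smul_right] using hx _ (two_mem e heL)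
    have hmdual : InDual q M m := hBM m hmM
    have hme : ¬ IsIntegral2 (Bq q m e) := fun h =>
      hmΛ ((memΛ m).2 ⟨mem_L m (dual_mono m hmdual) h, hMint m hmM⟩)
    have mem_M : ∀ y ∈ L, InDual q M y → y ∈ M := by
      intro y hy hyM
      by_contra hyM'
      have h1 := dual_mono m hmdual _ (coset y hy fun h => hyM' (hle h))
      have h2 := hyM m hmM
      rw [Bq_comm] at h2
      apply hme
      simpa [Bq_sub_right] using h2.sub h1
    refine hnoeven ⟨M, hM, fun x => ⟨fun hx => ?_, fun hx => hBM x hx⟩, hMint⟩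
    by_cases hxe : IsIntegral2 (Bq q x e)
    · exact mem_M x (mem_L x (dual_mono x hx) hxe) hx
    · have hsub : InDual q M (x - m) := fun y hy => by
        rw [Bq_sub_left]; exact (hx y hy).sub (hmdual y hy)
      have hint : IsIntegral2 (Bq q (x - m) e) := by
        rw [Bq_sub_left]
        exact isIntegral2_sub_of_not_isIntegral2 (two_Bq x (dual_mono x hx))
          (two_Bq m (dual_mono m hmdual)) hxe hme
      have h := mem_M (x - m) (mem_L _ (dual_mono _ hsub) hint) hsub
      simpa using M.add_mem h hmM
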